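/- arXiv:1506.05536 — 7 statements merged into one kernel-verified Lean document; each statement's English description precedes it below -/
import Mathlib

section
/- Let p be a real polynomial of degree at most 3 and let a < b be real numbers. Then p(x) ≥ 0 for all x ∈ [a,b] if and only if there exist real numbers c₁, c₂, d₁, d₂ such that p(x) = (x − a)(c₁x + c₂)² + (b − x)(d₁x + d₂)² for all x ∈ ℝ. -/
/-- If `α ^ 2 + B * s + C * s ^ 2` is nonnegative for all `s > 0`, its leading coefficient is. -/
lemma leadingCoeff_nonneg_of_forall_pos {α B C : ℝ}
    (h : ∀ s > 0, 0 ≤ α ^ 2 + B * s + C * s ^ 2) : 0 ≤ C := by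
  by_contra! hC
  have hq : 0 ≤ (α ^ 2 + |B|) / (-C) := div_nonneg (by positivity) (by linarith)
  set s := 1 + (α ^ 2 + |B|) / (-C) with hs
  have hCs : C * s = C - α ^ 2 - |B| := by
    have : C ≠ 0 := hC.ne
    rw [hs]
    field_simp
    ring
  have hpos := h s (by linarith)
  have hle : B + C * s ≤ C - α ^ 2 := by linarith [le_abs_self B]
  nlinarith [mul_le_mul_of_nonneg_left hle (by linarith : (0 : ℝ) ≤ s), sq_nonneg α]

/-- A quadratic nonnegative on the positive half-line with constant coefficient `α ^ 2` is of the
form `(α - y * s) ^ 2 + x ^ 2 * s`. -/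
lemma exists_quadratic_coeffs {α B C : ℝ} (hα : 0 ≤ α)
    (h : ∀ s > 0, 0 ≤ α ^ 2 + B * s + C * s ^ 2) :
    ∃ x y : ℝ, B = x ^ 2 - 2 * α * y ∧ C = y ^ 2 := by
  have hC := leadingCoeff_nonneg_of_forall_pos h
  have hy := Real.sqrt_nonneg C
  have hy2 := Real.sq_sqrt hC
  set y := √C
  have key : 0 ≤ B + 2 * α * y := by
    by_contra! hneg
    rcases hα.eq_or_lt with rfl | hα
    · have hB : 0 < -B := by linarith
      have hs : 0 < -B / (C + 1) := by positivity
      have hCs : C * (-B / (C + 1)) < -B := by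
        rw [← mul_div_assoc, div_lt_iff₀ (by linarith)]
        nlinarith
      nlinarith [h _ hs]
    · rcases hy.eq_or_lt with hy0 | hy0
      · have hB : B < 0 := by rw [← hy0] at hneg; linarith
        have hC0 : C = 0 := by rw [← hy2, ← hy0]; ring
        have hs : 0 < (α ^ 2 + 1) / (-B) := div_pos (by positivity) (by linarith)
        have hBs : B * ((α ^ 2 + 1) / (-B)) = -(α ^ 2 + 1) := by
          have : B ≠ 0 := hB.ne
          field_simp
        have := h _ hs
        rw [hC0, hBs] at this
        linarith
      · have hs : 0 < α / y := by positivity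
        have hys : y * (α / y) = α := by field_simp
        have hpos := h _ hs
        rw [← hy2] at hpos
        have : α ^ 2 + B * (α / y) + y ^ 2 * (α / y) ^ 2 = (α / y) * (B + 2 * α * y) := by
          linear_combination (y * (α / y) + α - 2 * α) * hys
        nlinarith
  refine ⟨√(B + 2 * α * y), y, ?_, hy2.symm⟩
  rw [Real.sq_sqrt key]
  ring

/-- On the parabola `C = y ^ 2 - 2 * δ * x` the function `x ^ 2 - 2 * α * y` attains every value
above one that it takes. -/
lemma exists_coeffs_of_le {α δ B C x₀ y₀ : ℝ} (hδ : 0 < δ)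
    (hB : x₀ ^ 2 - 2 * α * y₀ ≤ B) (hC : C = y₀ ^ 2 - 2 * δ * x₀) :
    ∃ x y : ℝ, B = x ^ 2 - 2 * α * y ∧ C = y ^ 2 - 2 * δ * x := by
  let g : ℝ → ℝ := fun y ↦ ((y ^ 2 - C) / (2 * δ)) ^ 2 - 2 * α * y
  have hcont : Continuous g := by fun_prop
  have hg₀ : g y₀ ≤ B := by
    have : (y₀ ^ 2 - C) / (2 * δ) = x₀ := by
      rw [hC]
      field_simp
      ring
    simpa only [g, this] using hB
  obtain ⟨Y, hY, hgY⟩ : ∃ Y, y₀ ≤ Y ∧ B ≤ g Y := by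
    let M := 1 + |y₀| + |B| + 2 * |α| + 2 * δ + |C|
    have hα := abs_nonneg α
    have hC' := abs_nonneg C
    have hB' := abs_nonneg B
    have hy' := abs_nonneg y₀
    have hM1 : 1 ≤ M := by simp only [M]; linarith
    have hMB : |B| + 2 * |α| ≤ M := by simp only [M]; linarith
    have hMδ : 1 + |C| + 2 * δ ≤ M := by simp only [M]; linarith
    refine ⟨M, by simp only [M]; linarith [le_abs_self y₀], ?_⟩
    have hq : M ≤ (M ^ 2 - C) / (2 * δ) := by
      rw [le_div_iff₀ (by positivity)]
      nlinarith [le_abs_self C]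
    have hsq : M ^ 2 ≤ ((M ^ 2 - C) / (2 * δ)) ^ 2 := by gcongr
    have hαM : α * M ≤ |α| * M := by gcongr; exact le_abs_self α
    simp only [g]
    nlinarith [le_abs_self B]
  obtain ⟨y, -, hy⟩ := intermediate_value_Icc hY hcont.continuousOn ⟨hg₀, hgY⟩
  refine ⟨(y ^ 2 - C) / (2 * δ), y, hy.symm, ?_⟩
  field_simp
  ring

/-- A cubic nonnegative on the positive half-line is of the form
`(α - y * s) ^ 2 + s * (δ * s - x) ^ 2`. -/
lemma exists_cubic_coeffs {α δ B C : ℝ} (hα : 0 ≤ α) (hδ : 0 ≤ δ)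
    (h : ∀ s > 0, 0 ≤ α ^ 2 + B * s + C * s ^ 2 + δ ^ 2 * s ^ 3) :
    ∃ x y : ℝ, B = x ^ 2 - 2 * α * y ∧ C = y ^ 2 - 2 * δ * x := by
  rcases hδ.eq_or_lt with rfl | hδ
  · obtain ⟨x, y, hB, hC⟩ := exists_quadratic_coeffs (B := B) (C := C) hα
      fun s hs ↦ by simpa using h s hs
    exact ⟨x, y, hB, by simpa using hC⟩
  rcases hα.eq_or_lt with rfl | hα
  · obtain ⟨y, x, hC, hB⟩ := exists_quadratic_coeffs (B := C) (C := B) hδ.le fun s hs ↦ by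
      have hpos := mul_nonneg (h s⁻¹ (inv_pos.2 hs)) (pow_nonneg hs.le 3)
      have : δ ^ 2 + C * s + B * s ^ 2 =
          (0 ^ 2 + B * s⁻¹ + C * s⁻¹ ^ 2 + δ ^ 2 * s⁻¹ ^ 3) * s ^ 3 := by
        field_simp
        ring
      rwa [this]
    exact ⟨x, y, by simpa using hB, hC⟩
  -- A critical point of `s ↦ f s / s`, where `f` is the given cubic.
  obtain ⟨s, hs, hcrit⟩ : ∃ s > 0, 2 * δ ^ 2 * s ^ 3 + C * s ^ 2 = α ^ 2 := by
    let g : ℝ → ℝ := fun s ↦ 2 * δ ^ 2 * s ^ 3 + C * s ^ 2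
    have hcont : Continuous g := by fun_prop
    let M := 1 + (|C| + α ^ 2) / δ ^ 2
    have hM : 1 ≤ M := le_add_of_nonneg_right (by positivity)
    have hδM : δ ^ 2 * M = δ ^ 2 + |C| + α ^ 2 := by
      simp only [M]
      field_simp
      ring
    have hgM : α ^ 2 ≤ g M := by
      have hM2 : 1 ≤ M ^ 2 := one_le_pow₀ hM
      have : g M = M ^ 2 * (2 * (δ ^ 2 * M) + C) := by simp only [g]; ring
      rw [this, hδM]
      have : α ^ 2 ≤ 2 * (δ ^ 2 + |C| + α ^ 2) + C := by
        linarith [neg_abs_le C, abs_nonneg C, sq_nonneg α, sq_nonneg δ]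
      nlinarith [sq_nonneg α]
    have hg0 : g 0 ≤ α ^ 2 := by simp only [g]; nlinarith
    obtain ⟨s, hs, hgs⟩ :=
      intermediate_value_Icc (by linarith : (0 : ℝ) ≤ M) hcont.continuousOn ⟨hg0, hgM⟩
    refine ⟨s, hs.1.lt_of_ne ?_, hgs⟩
    rintro rfl
    simp only [g] at hgs
    nlinarith [pow_pos hα 2]
  refine exists_coeffs_of_le (x₀ := δ * s) (y₀ := α / s) hδ ?_ ?_
  · have hpos := h s hs
    have : (δ * s) ^ 2 - 2 * α * (α / s) = (δ ^ 2 * s ^ 3 - 2 * α ^ 2) / s := by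
      field_simp
    rw [this, div_le_iff₀ hs]
    linarith
  · field_simp
    linarith

/-- **Markov–Lukacs theorem** for cubics: a real polynomial of degree at most 3 is
nonnegative on `[a, b]` (with `a < b`) iff it can be written as
`(x − a)(c₁x + c₂)² + (b − x)(d₁x + d₂)²`. -/
theorem markov_lukacs_cubic (p : Polynomial ℝ) (hp : p.degree ≤ 3)
    (a b : ℝ) (hab : a < b) :
    (∀ x ∈ Set.Icc a b, 0 ≤ p.eval x) ↔
      ∃ c₁ c₂ d₁ d₂ : ℝ, ∀ x : ℝ,
        p.eval x = (x - a) * (c₁ * x + c₂) ^ 2 + (b - x) * (d₁ * x + d₂) ^ 2 := by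
  constructor
  · intro h
    have hdeg : p.natDegree < 4 := by
      have := Polynomial.natDegree_le_of_degree_le (n := 3) hp
      omega
    have heval (x : ℝ) : p.eval x =
        p.coeff 0 + p.coeff 1 * x + p.coeff 2 * x ^ 2 + p.coeff 3 * x ^ 3 := by
      rw [Polynomial.eval_eq_sum_range' hdeg]
      simp [Finset.sum_range_succ]
    have hba : 0 < b - a := sub_pos.2 hab
    have hk : 0 < (b - a) ^ 3 := by positivity
    set k := (b - a) ^ 3
    let B := (3 * p.coeff 0 + p.coeff 1 * (2 * a + b) + p.coeff 2 * (a ^ 2 + 2 * a * b)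
      + p.coeff 3 * (3 * a ^ 2 * b)) / k
    let C := (3 * p.coeff 0 + p.coeff 1 * (a + 2 * b) + p.coeff 2 * (2 * a * b + b ^ 2)
      + p.coeff 3 * (3 * a * b ^ 2)) / k
    have hA : 0 ≤ p.eval a / k := div_nonneg (h a ⟨le_rfl, hab.le⟩) hk.le
    have hD : 0 ≤ p.eval b / k := div_nonneg (h b ⟨hab.le, le_rfl⟩) hk.le
    have hα := Real.sq_sqrt hA
    have hδ := Real.sq_sqrt hD
    set α := √(p.eval a / k)
    set δ := √(p.eval b / k)
    have hbern (x : ℝ) : p.eval x = α ^ 2 * (b - x) ^ 3 + B * (b - x) ^ 2 * (x - a)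
        + C * (b - x) * (x - a) ^ 2 + δ ^ 2 * (x - a) ^ 3 := by
      rw [hα, hδ]
      simp only [B, C, heval]
      field_simp
      simp only [k]
      ring
    obtain ⟨x, y, hB, hC⟩ := exists_cubic_coeffs (B := B) (C := C)
        (Real.sqrt_nonneg (p.eval a / k)) (Real.sqrt_nonneg (p.eval b / k)) fun s hs ↦ by
      have hs1 : 0 < 1 + s := by linarith
      have hu : b - (a + b * s) / (1 + s) = (b - a) / (1 + s) := by
        field_simp
        ring
      have hv : (a + b * s) / (1 + s) - a = s * ((b - a) / (1 + s)) := by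
        field_simp
        ring
      have hw : 0 < (b - a) / (1 + s) := by positivity
      have hpos := h ((a + b * s) / (1 + s))
        ⟨by nlinarith [mul_pos hs hw], by linarith⟩
      rw [hbern, hu, hv] at hpos
      refine nonneg_of_mul_nonneg_left (b := ((b - a) / (1 + s)) ^ 3) ?_ (by positivity)
      refine hpos.trans_eq ?_
      ring
    refine ⟨δ + x, -(δ * a + x * b), -(α + y), α * b + y * a, fun t ↦ ?_⟩
    rw [hbern, hB, hC]
    ring
  · rintro ⟨c₁, c₂, d₁, d₂, h⟩ x ⟨hax, hxb⟩
    rw [h]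
    exact add_nonneg (mul_nonneg (sub_nonneg.2 hax) (sq_nonneg _))
      (mul_nonneg (sub_nonneg.2 hxb) (sq_nonneg _))
end

section
/- Let p be a real polynomial of degree at most 3 and let a < b be real numbers. Then p(x) ≥ 0 for all x ∈ [a,b] if and only if there exist real symmetric positive semidefinite 2×2 matrices C = [[c₁₁, c₁₂],[c₁₂, c₂₂]] and D = [[d₁₁, d₁₂],[d₁₂, d₂₂]] such that p(x) = (x − a)(c₁₁x² + 2c₁₂x + c₂₂) + (b − x)(d₁₁x² + 2d₁₂x + d₂₂) for all x ∈ ℝ. -/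
open Set

/-- A continuous function that is nonnegative on an open interval is nonnegative on its closure. -/
theorem nonneg_on_Icc_of_nonneg_on_Ioo {f : ℝ → ℝ} (hf : Continuous f) {a b : ℝ} (hab : a < b)
    (h : ∀ x ∈ Ioo a b, 0 ≤ f x) : ∀ x ∈ Icc a b, 0 ≤ f x := by
  intro x hx
  rw [← closure_Ioo hab.ne] at hx
  exact closure_minimal (t := {x | 0 ≤ f x}) h (isClosed_le continuous_const hf) hx

/-- The Gram matrix of a quadratic is positive semidefinite iff the quadratic is nonnegative. -/
theorem posSemidef_iff_forall_quadratic_nonneg (c₁ c₂ c₃ : ℝ) :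
    (!![c₁, c₂; c₂, c₃] : Matrix (Fin 2) (Fin 2) ℝ).PosSemidef ↔
      ∀ x : ℝ, 0 ≤ c₁ * x ^ 2 + 2 * c₂ * x + c₃ := by
  rw [Matrix.posSemidef_iff_dotProduct_mulVec]
  constructor
  · rintro ⟨-, h⟩ x
    have := h ![x, 1]
    simp [Matrix.mulVec, dotProduct, Fin.sum_univ_two] at this
    linarith
  · intro h
    refine ⟨?_, fun v => ?_⟩
    · ext i j
      fin_cases i <;> fin_cases j <;> simp
    · have key : 0 ≤ c₁ * v 0 ^ 2 + 2 * c₂ * v 0 * v 1 + c₃ * v 1 ^ 2 := by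
        by_cases hv : v 1 = 0
        · have h₁ : 0 ≤ c₁ := by
            by_contra! hc
            have hd := discrim_le_zero (a := c₁) (b := 2 * c₂) (c := c₃)
              (fun x => by have := h x; linarith)
            have h₀ := h 0
            have h₁ := h 1
            have h₂ := h (-1)
            unfold discrim at hd
            nlinarith
          rw [hv]
          nlinarith [mul_nonneg h₁ (sq_nonneg (v 0))]
        · have := mul_nonneg (h (v 0 / v 1)) (sq_nonneg (v 1))
          field_simp at this
          linarith
      simp [Matrix.mulVec, dotProduct, Fin.sum_univ_two]
      linarith

/-- A quadratic that is nonnegative on `[a, b]` dominates a nonnegative multiple of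
`(x - a) * (b - x)` on the whole line. -/
theorem exists_mul_le_quadratic {a b : ℝ} (hab : a < b) (A B C : ℝ)
    (h : ∀ x ∈ Icc a b, 0 ≤ A * x ^ 2 + B * x + C) :
    ∃ c : ℝ, 0 ≤ c ∧ ∀ x : ℝ, 0 ≤ A * x ^ 2 + B * x + C - c * ((x - a) * (b - x)) := by
  obtain ⟨t, ht, hmin⟩ := isCompact_Icc.exists_isMinOn (nonempty_Icc.2 hab.le)
    (f := fun x : ℝ => A * x ^ 2 + B * x + C) (by fun_prop)
  have hm : ∀ x ∈ Icc a b, 0 ≤ (x - t) * (A * (x + t) + B) := by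
    intro x hx
    have : A * t ^ 2 + B * t + C ≤ A * x ^ 2 + B * x + C := hmin hx
    linarith
  have ht₀ := h t ht
  have hcont : Continuous fun x : ℝ => A * (x + t) + B := by fun_prop
  have hright : t < b → ∀ x ∈ Icc t b, 0 ≤ A * (x + t) + B := fun htb =>
    nonneg_on_Icc_of_nonneg_on_Ioo hcont htb fun x hx =>
      nonneg_of_mul_nonneg_right (hm x ⟨ht.1.trans hx.1.le, hx.2.le⟩) (sub_pos.2 hx.1)
  have hleft : a < t → ∀ x ∈ Icc a t, 0 ≤ -(A * (x + t) + B) := fun hta =>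
    nonneg_on_Icc_of_nonneg_on_Ioo (f := fun x => -(A * (x + t) + B)) hcont.neg hta fun x hx =>
      nonneg_of_mul_nonneg_right (a := t - x)
        (by have := hm x ⟨hx.1.le, hx.2.le.trans ht.2⟩; linarith) (sub_pos.2 hx.2)
  rcases ht.1.eq_or_lt with rfl | hta
  · have h₁ := hright hab a ⟨le_rfl, hab.le⟩
    have h₂ := hright hab b ⟨hab.le, le_rfl⟩
    refine ⟨(A * (a + a) + B) / (b - a), div_nonneg h₁ (sub_pos.2 hab).le, fun x => ?_⟩
    have e : A * x ^ 2 + B * x + C - (A * (a + a) + B) / (b - a) * ((x - a) * (b - x)) =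
        A * a ^ 2 + B * a + C + (A * (b + a) + B) / (b - a) * (x - a) ^ 2 := by
      have := (sub_pos.2 hab).ne'
      field_simp
      ring
    rw [e]
    have := div_nonneg h₂ (sub_pos.2 hab).le
    positivity
  rcases ht.2.eq_or_lt with rfl | htb
  · have h₁ := hleft hab a ⟨le_rfl, hab.le⟩
    have h₂ := hleft hab t ⟨hab.le, le_rfl⟩
    refine ⟨-(A * (t + t) + B) / (t - a), div_nonneg h₂ (sub_pos.2 hab).le, fun x => ?_⟩
    have e : A * x ^ 2 + B * x + C - -(A * (t + t) + B) / (t - a) * ((x - a) * (t - x)) =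
        A * t ^ 2 + B * t + C + -(A * (a + t) + B) / (t - a) * (t - x) ^ 2 := by
      have := (sub_pos.2 hab).ne'
      field_simp
      ring
    rw [e]
    have := div_nonneg h₁ (sub_pos.2 hab).le
    positivity
  · have h₁ := hright htb t ⟨le_rfl, htb.le⟩
    have h₂ := hleft hta t ⟨hta.le, le_rfl⟩
    have h₃ := hright htb b ⟨htb.le, le_rfl⟩
    have hB : B = -(2 * A * t) := by linarith
    have hA : 0 ≤ A := nonneg_of_mul_nonneg_left (b := b - t)
      (by rw [hB] at h₃; linarith) (sub_pos.2 htb)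
    refine ⟨0, le_rfl, fun x => ?_⟩
    have := mul_nonneg hA (sq_nonneg (x - t))
    subst hB
    linarith

/-- The interval certificate for cubics, with nonnegative quadratics as multipliers. -/
theorem exists_quadratic_multipliers {a b : ℝ} (hab : a < b) (A B C D : ℝ)
    (h : ∀ x ∈ Icc a b, 0 ≤ A * x ^ 3 + B * x ^ 2 + C * x + D) :
    ∃ c₁ c₂ c₃ d₁ d₂ d₃ : ℝ,
      (∀ x : ℝ, 0 ≤ c₁ * x ^ 2 + 2 * c₂ * x + c₃) ∧
      (∀ x : ℝ, 0 ≤ d₁ * x ^ 2 + 2 * d₂ * x + d₃) ∧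
      ∀ x : ℝ, A * x ^ 3 + B * x ^ 2 + C * x + D =
        (x - a) * (c₁ * x ^ 2 + 2 * c₂ * x + c₃) + (b - x) * (d₁ * x ^ 2 + 2 * d₂ * x + d₃) := by
  have hL : 0 < b - a := sub_pos.2 hab
  obtain ⟨t, ht, hmin⟩ := isCompact_Icc.exists_isMinOn (nonempty_Icc.2 hab.le)
    (f := fun x : ℝ => A * x ^ 3 + B * x ^ 2 + C * x + D) (by fun_prop)
  set m := A * t ^ 3 + B * t ^ 2 + C * t + D with hmdef
  have hm₀ : 0 ≤ m / (b - a) := div_nonneg (h t ht) hL.le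
  -- It suffices to certify `p - m`.
  suffices H : ∃ c₁ c₂ c₃ d₁ d₂ d₃ : ℝ,
      (∀ x : ℝ, 0 ≤ c₁ * x ^ 2 + 2 * c₂ * x + c₃) ∧
      (∀ x : ℝ, 0 ≤ d₁ * x ^ 2 + 2 * d₂ * x + d₃) ∧
      ∀ x : ℝ, A * x ^ 3 + B * x ^ 2 + C * x + D - m =
        (x - a) * (c₁ * x ^ 2 + 2 * c₂ * x + c₃) +
          (b - x) * (d₁ * x ^ 2 + 2 * d₂ * x + d₃) by
    obtain ⟨c₁, c₂, c₃, d₁, d₂, d₃, hc, hd, e⟩ := H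
    refine ⟨c₁, c₂, c₃ + m / (b - a), d₁, d₂, d₃ + m / (b - a),
      fun x => by linarith [hc x], fun x => by linarith [hd x], fun x => ?_⟩
    have h₁ : m / (b - a) * (b - a) = m := div_mul_cancel₀ _ hL.ne'
    linear_combination e x - h₁
  set B' := B + A * t with hB'
  set C' := C + B * t + A * t ^ 2 with hC'
  have hfac : ∀ x, A * x ^ 3 + B * x ^ 2 + C * x + D - m = (x - t) * (A * x ^ 2 + B' * x + C') :=
    fun x => by rw [hmdef, hB', hC']; ring
  have hm : ∀ x ∈ Icc a b, 0 ≤ (x - t) * (A * x ^ 2 + B' * x + C') := by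
    intro x hx
    have : m ≤ A * x ^ 3 + B * x ^ 2 + C * x + D := hmin hx
    rw [← hfac]
    linarith
  simp only [hfac]
  clear_value m B' C'
  have hcont : Continuous fun x : ℝ => A * x ^ 2 + B' * x + C' := by fun_prop
  have hright : t < b → ∀ x ∈ Icc t b, 0 ≤ A * x ^ 2 + B' * x + C' := fun htb =>
    nonneg_on_Icc_of_nonneg_on_Ioo hcont htb fun x hx =>
      nonneg_of_mul_nonneg_right (hm x ⟨ht.1.trans hx.1.le, hx.2.le⟩) (sub_pos.2 hx.1)
  have hleft : a < t → ∀ x ∈ Icc a t, 0 ≤ -(A * x ^ 2 + B' * x + C') := fun hta =>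
    nonneg_on_Icc_of_nonneg_on_Ioo (f := fun x => -(A * x ^ 2 + B' * x + C')) hcont.neg hta fun x hx =>
      nonneg_of_mul_nonneg_right (a := t - x)
        (by have := hm x ⟨hx.1.le, hx.2.le.trans ht.2⟩; linarith) (sub_pos.2 hx.2)
  rcases ht.1.eq_or_lt with rfl | hta
  · obtain ⟨c, hc, hq⟩ := exists_mul_le_quadratic hab A B' C' (hright hab)
    refine ⟨A + c, (B' - c * (a + b)) / 2, C' + c * a * b, c, -c * a, c * a ^ 2,
      fun x => ?_, fun x => ?_, fun x => by ring⟩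
    · linarith [hq x]
    · linarith [mul_nonneg hc (sq_nonneg (x - a))]
  rcases ht.2.eq_or_lt with rfl | htb
  · obtain ⟨c, hc, hq⟩ := exists_mul_le_quadratic hab (-A) (-B') (-C')
      (fun x hx => by linarith [hleft hab x hx])
    refine ⟨c, -c * t, c * t ^ 2, -A + c, (-B' - c * (a + t)) / 2, -C' + c * a * t,
      fun x => ?_, fun x => ?_, fun x => by ring⟩
    · linarith [mul_nonneg hc (sq_nonneg (x - t))]
    · linarith [hq x]
  · have h₁ := hright htb t ⟨le_rfl, htb.le⟩
    have h₂ := hleft hta t ⟨hta.le, le_rfl⟩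
    have hC : C' = -(A * t ^ 2 + B' * t) := by linarith
    subst hC
    have hb : 0 ≤ A * (b + t) + B' := nonneg_of_mul_nonneg_right (a := b - t)
      (by linarith [hright htb b ⟨htb.le, le_rfl⟩]) (sub_pos.2 htb)
    have ha : 0 ≤ A * (a + t) + B' := nonneg_of_mul_nonneg_right (a := t - a)
      (by linarith [hleft hta a ⟨le_rfl, hta.le⟩]) (sub_pos.2 hta)
    obtain ⟨β, hβ⟩ : ∃ β, β = (A * (b + t) + B') / (b - a) := ⟨_, rfl⟩
    obtain ⟨α, hα⟩ : ∃ α, α = (A * (a + t) + B') / (b - a) := ⟨_, rfl⟩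
    have hβ₀ : 0 ≤ β := hβ ▸ div_nonneg hb hL.le
    have hα₀ : 0 ≤ α := hα ▸ div_nonneg ha hL.le
    refine ⟨β, -β * t, β * t ^ 2, α, -α * t, α * t ^ 2, fun x => ?_, fun x => ?_, fun x => ?_⟩
    · linarith [mul_nonneg hβ₀ (sq_nonneg (x - t))]
    · linarith [mul_nonneg hα₀ (sq_nonneg (x - t))]
    · rw [hα, hβ]
      have := hL.ne'
      field_simp
      ring

/-- Markov–Lukacs with PSD Gram matrices: a real polynomial of degree at most 3 is
nonnegative on `[a, b]` (with `a < b`) iff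
`p(x) = (x − a)(c₁₁x² + 2c₁₂x + c₂₂) + (b − x)(d₁₁x² + 2d₁₂x + d₂₂)`
for positive semidefinite matrices `[[c₁₁, c₁₂], [c₁₂, c₂₂]]` and `[[d₁₁, d₁₂], [d₁₂, d₂₂]]`. -/
theorem markov_lukacs_cubic_psd (p : Polynomial ℝ) (hp : p.degree ≤ 3)
    (a b : ℝ) (hab : a < b) :
    (∀ x ∈ Set.Icc a b, 0 ≤ p.eval x) ↔
      ∃ c₁₁ c₁₂ c₂₂ d₁₁ d₁₂ d₂₂ : ℝ,
        (Matrix.PosSemidef (!![c₁₁, c₁₂; c₁₂, c₂₂] : Matrix (Fin 2) (Fin 2) ℝ)) ∧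
        (Matrix.PosSemidef (!![d₁₁, d₁₂; d₁₂, d₂₂] : Matrix (Fin 2) (Fin 2) ℝ)) ∧
        ∀ x : ℝ, p.eval x =
          (x - a) * (c₁₁ * x ^ 2 + 2 * c₁₂ * x + c₂₂)
            + (b - x) * (d₁₁ * x ^ 2 + 2 * d₁₂ * x + d₂₂) := by
  simp only [posSemidef_iff_forall_quadratic_nonneg]
  constructor
  · intro h
    have heval : ∀ x : ℝ, p.eval x =
        p.coeff 3 * x ^ 3 + p.coeff 2 * x ^ 2 + p.coeff 1 * x + p.coeff 0 := by
      intro x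
      rw [Polynomial.eval_eq_sum_range' (n := 4)
        (Nat.lt_succ_of_le (Polynomial.natDegree_le_of_degree_le hp))]
      simp only [Finset.sum_range_succ, Finset.sum_range_zero]
      ring
    simp only [heval] at h ⊢
    exact exists_quadratic_multipliers hab _ _ _ _ h
  · rintro ⟨c₁, c₂, c₃, d₁, d₂, d₃, hc, hd, e⟩ x hx
    rw [e x]
    exact add_nonneg (mul_nonneg (sub_nonneg.2 hx.1) (hc x))
      (mul_nonneg (sub_nonneg.2 hx.2) (hd x))
end

section
/- Let a < b be real numbers and β₀, β₁, β₂, β₃ ∈ ℝ. The cubic polynomial p(x) = β₃x³ + β₂x² + β₁x + β₀ satisfies p(x) ≥ 0 for all x ∈ [a,b] if and only if there exist real numbers c₁₁, c₁₂, c₂₂, d₁₁, d₁₂, d₂₂ such that: β₃ = c₁₁ − d₁₁; β₂ = −a·c₁₁ + 2c₁₂ + b·d₁₁ − 2d₁₂; β₁ = −2a·c₁₂ + c₂₂ + 2b·d₁₂ − d₂₂; β₀ = −a·c₂₂ + b·d₂₂; c₁₁ ≥ 0, c₂₂ ≥ 0, d₁₁ ≥ 0, d₂₂ ≥ 0; c₁₂²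 ≤ c₁₁c₂₂ and d₁₂² ≤ d₁₁d₂₂. -/
theorem quadratic_form_nonneg {p q r : ℝ} (hp : 0 ≤ p) (hr : 0 ≤ r) (h : q ^ 2 ≤ p * r)
    (u v : ℝ) : 0 ≤ p * u ^ 2 + 2 * q * (u * v) + r * v ^ 2 := by
  rcases hp.eq_or_lt with rfl | hp
  · have hq : q = 0 := by nlinarith [sq_nonneg q]
    subst hq
    nlinarith [mul_nonneg hr (sq_nonneg v)]
  · have h1 : 0 ≤ p * (p * u ^ 2 + 2 * q * (u * v) + r * v ^ 2) := by
      nlinarith [sq_nonneg (p * u + q * v), mul_nonneg (sub_nonneg.2 h) (sq_nonneg v)]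
    exact nonneg_of_mul_nonneg_right h1 hp

theorem leadingCoeff_nonneg_of_quadratic_nonneg {A B C : ℝ}
    (h : ∀ t > 0, 0 ≤ A + B * t + C * t ^ 2) : 0 ≤ C := by
  by_contra! hC
  have hs : 0 ≤ (|A| + |B|) / -C := by
    have : 0 < -C := by linarith
    positivity
  obtain ⟨t, ht⟩ : ∃ t, t = (|A| + |B|) / -C + 1 := ⟨_, rfl⟩
  have ht1 : 1 ≤ t := by linarith
  have hCt : |A| + |B| + C * t = C := by
    rw [ht]
    field_simp [hC.ne]
    ring
  have := h t (by linarith)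
  have hA : A ≤ |A| * t := by nlinarith [le_abs_self A, abs_nonneg A]
  have hB : B * t ≤ |B| * t := by nlinarith [le_abs_self B]
  nlinarith

theorem constCoeff_nonneg_of_quadratic_nonneg {A B C : ℝ}
    (h : ∀ t > 0, 0 ≤ A + B * t + C * t ^ 2) : 0 ≤ A := by
  refine leadingCoeff_nonneg_of_quadratic_nonneg (A := C) (B := B) fun t ht ↦ ?_
  have h1 := mul_nonneg (h t⁻¹ (inv_pos.2 ht)) (sq_nonneg t)
  have h2 : (A + B * t⁻¹ + C * t⁻¹ ^ 2) * t ^ 2 = C + B * t + A * t ^ 2 := by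
    field_simp
    ring
  rwa [h2] at h1

theorem middleCoeff_add_sqrt_nonneg {A B C : ℝ}
    (h : ∀ t > 0, 0 ≤ A + B * t + C * t ^ 2) : 0 ≤ B + 2 * √(A * C) := by
  have hA := constCoeff_nonneg_of_quadratic_nonneg h
  have hC := leadingCoeff_nonneg_of_quadratic_nonneg h
  by_contra! hlt
  have hs := Real.sqrt_nonneg (A * C)
  have hs2 := Real.sq_sqrt (mul_nonneg hA hC)
  have hB : B < 0 := by linarith
  rcases hC.eq_or_lt with rfl | hC
  · have := h ((A + 1) / -B) (div_pos (by linarith) (by linarith))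
    have h2 : B * ((A + 1) / -B) = -(A + 1) := by field_simp [hB.ne]
    linarith
  · have := mul_nonneg (h (-B / (2 * C)) (div_pos (by linarith) (by linarith))) hC.le
    have h2 : (A + B * (-B / (2 * C)) + C * (-B / (2 * C)) ^ 2) * C = A * C - B ^ 2 / 4 := by
      field_simp
      ring
    nlinarith

/-- A cubic nonnegative on the half-line is `σ₀ + t σ₁` with `σ₀`, `σ₁` quadratics that are
nonnegative on `ℝ`. -/
theorem exists_quadratics_of_cubic_nonneg {A B C D : ℝ} (hA : 0 ≤ A) (hD : 0 ≤ D)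
    (H : ∀ t > 0, 0 ≤ A + B * t + C * t ^ 2 + D * t ^ 3) :
    ∃ e f g h : ℝ, 0 ≤ f ∧ 0 ≤ g ∧ 2 * e + g = B ∧ f + 2 * h = C ∧
      e ^ 2 ≤ A * f ∧ h ^ 2 ≤ g * D := by
  rcases hD.eq_or_lt with rfl | hD
  · have hq : ∀ t > 0, 0 ≤ A + B * t + C * t ^ 2 := fun t ht ↦ by simpa using H t ht
    have hC := leadingCoeff_nonneg_of_quadratic_nonneg hq
    refine ⟨-√(A * C), C, B + 2 * √(A * C), 0, hC, middleCoeff_add_sqrt_nonneg hq,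
      by ring, by ring, ?_, by simp⟩
    rw [neg_sq, Real.sq_sqrt (mul_nonneg hA hC)]
  rcases hA.eq_or_lt with rfl | hA
  · have hq : ∀ t > 0, 0 ≤ B + C * t + D * t ^ 2 := fun t ht ↦
      nonneg_of_mul_nonneg_right (by linear_combination H t ht) ht
    have hB := constCoeff_nonneg_of_quadratic_nonneg hq
    refine ⟨0, C + 2 * √(B * D), B, -√(B * D), middleCoeff_add_sqrt_nonneg hq, hB,
      by ring, by ring, by simp, ?_⟩
    rw [neg_sq, Real.sq_sqrt (mul_nonneg hB hD.le)]
  -- a critical point of `t ↦ (A + B t + C t² + D t³) / t`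
  obtain ⟨s, hs, hroot⟩ : ∃ s > 0, 2 * D * s ^ 3 + C * s ^ 2 - A = 0 := by
    let M := (|C| + A) / (2 * D) + 1
    have hM : 1 ≤ M := by
      have : 0 ≤ (|C| + A) / (2 * D) := by positivity
      linarith
    have hDM : 2 * D * M = |C| + A + 2 * D := by
      simp only [M]
      field_simp
    have hf : ContinuousOn (fun s : ℝ ↦ 2 * D * s ^ 3 + C * s ^ 2 - A) (Set.Icc 0 M) := by
      fun_prop
    have hpos : 0 ≤ 2 * D * M ^ 3 + C * M ^ 2 - A := by
      have h1 : 2 * D * M ^ 3 + C * M ^ 2 - A = (|C| + C + A + 2 * D) * M ^ 2 - A := by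
        linear_combination M ^ 2 * hDM
      have h2 : A ≤ |C| + C + A + 2 * D := by linarith [neg_abs_le C]
      nlinarith [mul_nonneg (hA.le.trans h2) (sub_nonneg.2 (one_le_pow₀ hM (n := 2)))]
    obtain ⟨s, hs, h0⟩ := intermediate_value_Icc (by linarith) hf
      (show (0 : ℝ) ∈ Set.Icc _ _ from ⟨by simpa using hA.le, hpos⟩)
    refine ⟨s, lt_of_le_of_ne hs.1 ?_, h0⟩
    rintro rfl
    simp at h0
    exact hA.ne' h0
  have hm : 0 ≤ B + 2 * (A / s) - D * s ^ 2 := by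
    refine nonneg_of_mul_nonneg_right (a := s) ?_ hs
    have h1 : s * (B + 2 * (A / s) - D * s ^ 2) = A + B * s + C * s ^ 2 + D * s ^ 3 := by
      field_simp
      linear_combination -hroot
    rw [h1]
    exact H s hs
  refine ⟨-(A / s), A / s ^ 2, B + 2 * (A / s), -(D * s), by positivity, ?_, by ring, ?_,
    le_of_eq ?_, ?_⟩
  · nlinarith [mul_pos hD (pow_pos hs 2)]
  · field_simp
    linear_combination -hroot
  · field_simp
  · nlinarith

/-- Explicit coefficient-wise characterization of cubics `β₃x³ + β₂x² + β₁x + β₀`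
nonnegative on `[a, b]` (with `a < b`), via the Markov–Lukacs system of linear
equations together with nonnegativity and quadratic-cone inequalities. -/
theorem cubic_nonneg_iff_socp_system (a b : ℝ) (hab : a < b) (β₀ β₁ β₂ β₃ : ℝ) :
    (∀ x ∈ Set.Icc a b, 0 ≤ β₃ * x ^ 3 + β₂ * x ^ 2 + β₁ * x + β₀) ↔
      ∃ c₁₁ c₁₂ c₂₂ d₁₁ d₁₂ d₂₂ : ℝ,
        β₃ = c₁₁ - d₁₁ ∧
        β₂ = -a * c₁₁ + 2 * c₁₂ + b * d₁₁ - 2 * d₁₂ ∧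
        β₁ = -2 * a * c₁₂ + c₂₂ + 2 * b * d₁₂ - d₂₂ ∧
        β₀ = -a * c₂₂ + b * d₂₂ ∧
        0 ≤ c₁₁ ∧ 0 ≤ c₂₂ ∧ 0 ≤ d₁₁ ∧ 0 ≤ d₂₂ ∧
        c₁₂ ^ 2 ≤ c₁₁ * c₂₂ ∧ d₁₂ ^ 2 ≤ d₁₁ * d₂₂ := by
  constructor
  · intro H
    have hL : 0 < b - a := sub_pos.2 hab
    obtain ⟨A, hA⟩ : ∃ A, A = β₃ * a ^ 3 + β₂ * a ^ 2 + β₁ * a + β₀ := ⟨_, rfl⟩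
    obtain ⟨D, hD⟩ : ∃ D, D = β₃ * b ^ 3 + β₂ * b ^ 2 + β₁ * b + β₀ := ⟨_, rfl⟩
    have hA0 : 0 ≤ A := hA ▸ H a ⟨le_rfl, hab.le⟩
    have hD0 : 0 ≤ D := hD ▸ H b ⟨hab.le, le_rfl⟩
    obtain ⟨e, f, g, h, hf, hg, hB, hC, he, hh⟩ := exists_quadratics_of_cubic_nonneg
      (B := 3 * β₃ * a ^ 2 * b + β₂ * (a ^ 2 + 2 * a * b) + β₁ * (2 * a + b) + 3 * β₀)
      (C := 3 * β₃ * a * b ^ 2 + β₂ * (b ^ 2 + 2 * a * b) + β₁ * (a + 2 * b) + 3 * β₀)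
      hA0 hD0 (by
        intro t ht
        have ht1 : 0 < 1 + t := by linarith
        have hx := H ((a + t * b) / (1 + t))
          ⟨(le_div_iff₀ ht1).2 (by nlinarith), (div_le_iff₀ ht1).2 (by nlinarith)⟩
        have := mul_nonneg hx (pow_pos ht1 3).le
        refine this.trans_eq ?_
        rw [hA, hD]
        field_simp
        ring)
    have hL3 : 0 < (b - a) ^ 3 := pow_pos hL 3
    refine ⟨(g - 2 * h + D) / (b - a) ^ 3, (-b * g + h * (a + b) - a * D) / (b - a) ^ 3,
      (g * b ^ 2 - 2 * h * (a * b) + D * a ^ 2) / (b - a) ^ 3,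
      (A - 2 * e + f) / (b - a) ^ 3, (-b * A + e * (a + b) - a * f) / (b - a) ^ 3,
      (A * b ^ 2 - 2 * e * (a * b) + f * a ^ 2) / (b - a) ^ 3, ?_, ?_, ?_, ?_,
      div_nonneg ?_ hL3.le, div_nonneg ?_ hL3.le, div_nonneg ?_ hL3.le, div_nonneg ?_ hL3.le,
      ?_, ?_⟩
    · field_simp
      linear_combination hA - hD - hB + hC
    · field_simp
      linear_combination (-3 * b) * hA + 3 * a * hD + (a + 2 * b) * hB - (2 * a + b) * hC
    · field_simp
      linear_combination 3 * b ^ 2 * hA - 3 * a ^ 2 * hD - (b ^ 2 + 2 * a * b) * hB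
        + (a ^ 2 + 2 * a * b) * hC
    · field_simp
      linear_combination (-b ^ 3) * hA + a ^ 3 * hD + a * b ^ 2 * hB - a ^ 2 * b * hC
    · linear_combination quadratic_form_nonneg hg hD0 hh 1 (-1)
    · linear_combination quadratic_form_nonneg hg hD0 hh b (-a)
    · linear_combination quadratic_form_nonneg hA0 hf he 1 (-1)
    · linear_combination quadratic_form_nonneg hA0 hf he b (-a)
    · rw [div_pow, div_mul_div_comm, ← sq]
      gcongr
      linear_combination (b - a) ^ 2 * hh
    · rw [div_pow, div_mul_div_comm, ← sq]
      gcongr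
      linear_combination (b - a) ^ 2 * he
  · rintro ⟨c₁₁, c₁₂, c₂₂, d₁₁, d₁₂, d₂₂, rfl, rfl, rfl, rfl, hc₁, hc₂, hd₁, hd₂, hc, hd⟩ x hx
    linear_combination
      mul_nonneg (sub_nonneg.2 hx.1) (quadratic_form_nonneg hc₁ hc₂ hc x 1) +
      mul_nonneg (sub_nonneg.2 hx.2) (quadratic_form_nonneg hd₁ hd₂ hd x 1)
end

section
/- Let t₁ ≤ t₂ ≤ ⋯ ≤ t_{n+1} be a nondecreasing sequence of real numbers. For each i ∈ {1, …, n}, let Gᵢ be the 4×6 matrix with rows (−1, 0, 0, 1, 0, 0), (tᵢ, −2, 0, −t_{i+1}, 2, 0), (0, 2tᵢ, −1, 0, −2t_{i+1}, 1), and (0, 0, tᵢ, 0, 0, −t_{i+1}). Then the 4n×6n block-diagonal matrix whose i-th diagonal block is Gᵢ has rank 4n − |{i ∈ {1, …, n} : tᵢ = t_{i+1}}|. In particular, any matrix with 4n rows that contains these 6n columns as a column submatrix has rank at least 4n − κ + ϱ, where κ is the total number of multiple knots counted with multiplicities and ϱ is the number of distinct multiple knots. -/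
/-- The kernel of the transposed Markov–Lukacs block is spanned by `(a³, a², a, 1)` if `a = b`,
and trivial otherwise. -/
theorem markovLukacsBlock_vecMul_eq_zero_iff (a b : ℝ) (y : Fin 4 → ℝ) :
    (∀ k, ∑ j, y j * (!![(-1 : ℝ), 0, 0, 1, 0, 0;
         a, -2, 0, -b, 2, 0;
         0, 2 * a, -1, 0, -2 * b, 1;
         0, 0, a, 0, 0, -b] : Matrix (Fin 4) (Fin 6) ℝ) j k = 0) ↔
      (∀ j, y j = a ^ (3 - (j : ℕ)) * y 3) ∧ (a ≠ b → y 3 = 0) := by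
  simp only [Fin.forall_fin_succ, Fin.sum_univ_succ]
  simp
  constructor
  · rintro ⟨h0, h1, h2, -, -, h5⟩
    have e2 : y 2 = a * y 3 := by linarith
    have e1 : y 1 = a ^ 2 * y 3 := by linear_combination (-1 / 2) * h1 + a * e2
    refine ⟨⟨by linear_combination (-1) * h0 + a * e1, e1, e2⟩, fun hab => ?_⟩
    have : (a - b) * y 3 = 0 := by linear_combination h2 + h5
    exact (mul_eq_zero.1 this).resolve_left (sub_ne_zero.2 hab)
  · rintro ⟨⟨h0, h1, h2⟩, h⟩
    have h3 : (a - b) * y 3 = 0 := by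
      by_cases hab : a = b
      · simp [hab]
      · simp [h hab]
    rw [h0, h1, h2]
    refine ⟨by ring, by ring, by ring, ?_, ?_, ?_⟩
    · linear_combination a ^ 2 * h3
    · linear_combination 2 * a * h3
    · linear_combination h3

/-- Passing to a family of columns does not increase the rank. -/
theorem Matrix.rank_le_of_columns {R l m p : Type*} [Field R] [Fintype l] [Fintype m] [Fintype p]
    (M : Matrix l m R) (B : Matrix l p R) (f : p → m) (h : ∀ i k, M i (f k) = B i k) :
    B.rank ≤ M.rank := by
  rw [Matrix.rank_eq_finrank_span_cols, Matrix.rank_eq_finrank_span_cols]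
  apply Submodule.finrank_mono
  apply Submodule.span_mono
  rintro _ ⟨k, rfl⟩
  exact ⟨f k, funext fun i => h i k⟩

open Classical in
/-- Among the multiple entries of a finite sequence, those that repeat their predecessor and the
distinct values are together at most as many as the entries. -/
theorem card_repeated_add_card_values_le {n : ℕ} {α : Type*} (t : Fin (n + 1) → α) :
    (Finset.univ.filter (fun i : Fin n => t i.castSucc = t i.succ)).card +
      ((Finset.univ.filter
        (fun i : Fin (n + 1) => ∃ j : Fin (n + 1), j ≠ i ∧ t j = t i)).image t).card ≤
      (Finset.univ.filter
        (fun i : Fin (n + 1) => ∃ j : Fin (n + 1), j ≠ i ∧ t j = t i)).card := by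
  set S := Finset.univ.filter
    (fun i : Fin (n + 1) => ∃ j : Fin (n + 1), j ≠ i ∧ t j = t i) with hS
  set D := (Finset.univ.filter (fun i : Fin n => t i.castSucc = t i.succ)) with hD
  have hDS : D.image Fin.succ ⊆ S := by
    intro x hx
    obtain ⟨i, hi, rfl⟩ := Finset.mem_image.1 hx
    simp only [hD, Finset.mem_filter, Finset.mem_univ, true_and] at hi
    simp only [hS, Finset.mem_filter, Finset.mem_univ, true_and]
    exact ⟨i.castSucc, (Fin.castSucc_lt_succ).ne, hi⟩
  have hcard : (D.image Fin.succ).card = D.card :=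
    Finset.card_image_of_injective _ (Fin.succ_injective n)
  have himg : S.image t ⊆ (S \ D.image Fin.succ).image t := by
    intro v hv
    have hne : (S.filter (fun i => t i = v)).Nonempty := by
      obtain ⟨i, hi, rfl⟩ := Finset.mem_image.1 hv
      exact ⟨i, by simp [hi]⟩
    obtain ⟨hm, hmin⟩ := Finset.isLeast_min' _ hne
    set i := (S.filter (fun i => t i = v)).min' hne
    obtain ⟨hiS, hiv⟩ := Finset.mem_filter.1 (Finset.mem_coe.1 hm)
    refine Finset.mem_image.2 ⟨i, Finset.mem_sdiff.2 ⟨hiS, fun hi => ?_⟩, hiv⟩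
    obtain ⟨j, hj, hji⟩ := Finset.mem_image.1 hi
    simp only [hD, Finset.mem_filter, Finset.mem_univ, true_and] at hj
    have hjS : j.castSucc ∈ S := by
      simp only [hS, Finset.mem_filter, Finset.mem_univ, true_and]
      exact ⟨j.succ, (Fin.castSucc_lt_succ).ne', hj.symm⟩
    have hle : i ≤ j.castSucc := hmin <| Finset.mem_coe.2 <|
      Finset.mem_filter.2 ⟨hjS, by rw [hj, hji, hiv]⟩
    rw [← hji] at hle
    exact absurd hle (not_le.2 Fin.castSucc_lt_succ)
  have h1 := (Finset.card_le_card himg).trans Finset.card_image_le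
  have h2 := Finset.card_sdiff_add_card_eq_card hDS
  omega

open Classical in
/-- The space of vectors `y (i, j) = a i ^ (3 - j) * z i` with `z` supported on `{i | P i}` has
dimension the number of indices satisfying `P`. -/
theorem finrank_cubicMoments {n : ℕ} (a : Fin n → ℝ) (P : Fin n → Prop)
    (K : Submodule ℝ (Fin n × Fin 4 → ℝ))
    (hK : ∀ y, y ∈ K ↔ ∀ i, (∀ j : Fin 4, y (i, j) = a i ^ (3 - (j : ℕ)) * y (i, 3)) ∧
      (¬ P i → y (i, 3) = 0)) :
    Module.finrank ℝ K = (Finset.univ.filter P).card := by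
  let e : K ≃ₗ[ℝ] ({i // P i} → ℝ) :=
    { toFun := fun y i => y.1 (i.1, 3)
      map_add' := fun _ _ => rfl
      map_smul' := fun _ _ => rfl
      invFun := fun z => ⟨fun p => a p.1 ^ (3 - (p.2 : ℕ)) * if h : P p.1 then z ⟨p.1, h⟩ else 0,
        (hK _).2 fun i => ⟨fun j => by simp, fun h => by simp [h]⟩⟩
      left_inv := by
        rintro ⟨y, hy⟩
        ext ⟨i, j⟩
        obtain ⟨h1, h2⟩ := (hK y).1 hy i
        by_cases h : P i
        · simp [h, h1 j]
        · simp [h, h1 j, h2 h]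
      right_inv := by
        intro z
        ext ⟨i, hi⟩
        simp [hi] }
  rw [e.finrank_eq, Module.finrank_fintype_fun_eq_card, Fintype.card_subtype]


open Classical in
/-- The block-diagonal coefficient matrix of the Markov–Lukacs nonnegativity constraints
for a cubic spline with nondecreasing knot sequence `t₁ ≤ ⋯ ≤ t_{n+1}` has rank
`4n − |{i : tᵢ = t_{i+1}}|`; in particular, any matrix with `4n` rows containing its
`6n` columns as a column submatrix has rank at least `4n − κ + ϱ`, where `κ` is the
number of multiple knots counted with multiplicities and `ϱ` is the number of distinct
multiple knots. -/
theorem rank_markov_lukacs_block_diagonal (n : ℕ) (t : Fin (n + 1) → ℝ) (ht : Monotone t)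
    (G : Fin n → Matrix (Fin 4) (Fin 6) ℝ)
    (hG : ∀ i : Fin n, G i =
      !![(-1 : ℝ), 0, 0, 1, 0, 0;
         t i.castSucc, -2, 0, -t i.succ, 2, 0;
         0, 2 * t i.castSucc, -1, 0, -2 * t i.succ, 1;
         0, 0, t i.castSucc, 0, 0, -t i.succ])
    (BD : Matrix (Fin n × Fin 4) (Fin n × Fin 6) ℝ)
    (hBD : ∀ p q, BD p q = if p.1 = q.1 then G p.1 p.2 q.2 else 0)
    (κ ϱ : ℕ)
    (hκ : κ = (Finset.univ.filter
      (fun i : Fin (n + 1) => ∃ j : Fin (n + 1), j ≠ i ∧ t j = t i)).card)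
    (hϱ : ϱ = ((Finset.univ.filter
      (fun i : Fin (n + 1) => ∃ j : Fin (n + 1), j ≠ i ∧ t j = t i)).image t).card) :
    BD.rank = 4 * n -
        (Finset.univ.filter (fun i : Fin n => t i.castSucc = t i.succ)).card ∧
      ∀ (m : Type) [Fintype m] (M : Matrix (Fin n × Fin 4) m ℝ)
        (f : Fin n × Fin 6 → m), Function.Injective f →
        (∀ p q, M p (f q) = BD p q) → 4 * n - κ + ϱ ≤ M.rank := by
  have hker : ∀ y, y ∈ LinearMap.ker BD.transpose.mulVecLin ↔
      ∀ i, (∀ j : Fin 4, y (i, j) = t i.castSucc ^ (3 - (j : ℕ)) * y (i, 3)) ∧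
        (¬ t i.castSucc = t i.succ → y (i, 3) = 0) := by
    intro y
    rw [LinearMap.mem_ker, funext_iff, Prod.forall]
    refine forall_congr' fun i => ?_
    rw [← ne_eq, ← markovLukacsBlock_vecMul_eq_zero_iff _ _ (fun j => y (i, j)), ← hG i]
    refine forall_congr' fun k => ?_
    simp only [Matrix.mulVecLin_apply, Matrix.mulVec, dotProduct, Matrix.transpose_apply, hBD,
      Fintype.sum_prod_type, Pi.zero_apply]
    rw [Finset.sum_eq_single i (fun b _ hb => by simp [hb]) (by simp)]
    simp [mul_comm]
  have hrank : BD.rank + (Finset.univ.filter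
      (fun i : Fin n => t i.castSucc = t i.succ)).card = 4 * n := by
    rw [← finrank_cubicMoments _ _ _ hker, ← Matrix.rank_transpose, Matrix.rank,
      LinearMap.finrank_range_add_finrank_ker]
    simp [mul_comm]
  refine ⟨by omega, fun m _ M f _ hM => ?_⟩
  have hle := Matrix.rank_le_of_columns M BD f hM
  have hcount := card_repeated_add_card_values_le t
  have hκn : κ ≤ n + 1 := by
    rw [hκ]
    exact (Finset.card_le_univ _).trans_eq (Fintype.card_fin _)
  have hκ0 : n = 0 → κ = 0 := by
    rintro rfl
    rw [hκ, Finset.card_eq_zero, Finset.filter_eq_empty_iff]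
    rintro i - ⟨j, hj, -⟩
    exact hj (Fin.ext (by omega))
  rw [← hκ, ← hϱ] at hcount
  omega
end

section
/- Let t₁ < t₂ < ⋯ < t_{n+1} be a strictly increasing sequence of real numbers, and for each i ∈ {1, …, n} let Gᵢ be the 4×6 matrix with rows (−1, 0, 0, 1, 0, 0), (tᵢ, −2, 0, −t_{i+1}, 2, 0), (0, 2tᵢ, −1, 0, −2t_{i+1}, 1), and (0, 0, tᵢ, 0, 0, −t_{i+1}). Then any real matrix M with 4n rows that contains, as a column submatrix, the 4n×6n block-diagonal matrix with diagonal blocks G₁, …, Gₙ has full row rank 4n. -/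
/-- The left kernel of a Markov–Lukacs coefficient block with distinct endpoints is trivial. -/
theorem markovLukacs_block_vecMul_eq_zero {a b : ℝ} (hab : a ≠ b) {v : Fin 4 → ℝ}
    (hv : Matrix.vecMul v !![(-1 : ℝ), 0, 0, 1, 0, 0;
      a, -2, 0, -b, 2, 0;
      0, 2 * a, -1, 0, -2 * b, 1;
      0, 0, a, 0, 0, -b] = 0) : v = 0 := by
  have h (j : Fin 6) := congrFun hv j
  have h0 := h 0
  have h1 := h 1
  have h2 := h 2
  have h5 := h 5
  simp [Matrix.vecMul, dotProduct, Fin.sum_univ_four] at h0 h1 h2 h5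
  have v3 : v 3 = 0 := by
    have : (a - b) * v 3 = 0 := by linear_combination h2 + h5
    exact (mul_eq_zero.mp this).resolve_left (sub_ne_zero.mpr hab)
  have v2 : v 2 = 0 := by linear_combination -h2 + a * v3
  have v1 : v 1 = 0 := by linear_combination -h1 / 2 + a * v2
  have v0 : v 0 = 0 := by linear_combination -h0 + a * v1
  ext k
  fin_cases k <;> assumption


/-- For strictly increasing knots `t₁ < ⋯ < t_{n+1}`, any matrix with `4n` rows that
contains the block-diagonal matrix of Markov–Lukacs coefficient blocks `G₁, …, Gₙ` as a
column submatrix has full row rank `4n`. -/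
theorem full_row_rank_markov_lukacs_distinct_knots (n : ℕ) (t : Fin (n + 1) → ℝ)
    (ht : StrictMono t)
    (G : Fin n → Matrix (Fin 4) (Fin 6) ℝ)
    (hG : ∀ i : Fin n, G i =
      !![(-1 : ℝ), 0, 0, 1, 0, 0;
         t i.castSucc, -2, 0, -t i.succ, 2, 0;
         0, 2 * t i.castSucc, -1, 0, -2 * t i.succ, 1;
         0, 0, t i.castSucc, 0, 0, -t i.succ])
    (BD : Matrix (Fin n × Fin 4) (Fin n × Fin 6) ℝ)
    (hBD : ∀ p q, BD p q = if p.1 = q.1 then G p.1 p.2 q.2 else 0)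
    (m : Type) [Fintype m] (M : Matrix (Fin n × Fin 4) m ℝ)
    (f : Fin n × Fin 6 → m) (hf : Function.Injective f)
    (hMf : ∀ p q, M p (f q) = BD p q) :
    M.rank = 4 * n := by
  have hrow : LinearIndependent ℝ M.row := by
    rw [← Matrix.vecMul_injective_iff]
    refine (injective_iff_map_eq_zero M.vecMulLinear).mpr fun v hv => ?_
    have hblock (i : Fin n) : (fun k => v (i, k)) = 0 := by
      refine markovLukacs_block_vecMul_eq_zero (ht i.castSucc_lt_succ).ne ?_
      rw [← hG i]
      ext j
      have h := congrFun hv (f (i, j))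
      simpa [Matrix.vecMul, dotProduct, hMf, hBD, Fintype.sum_prod_type] using h
    ext ⟨i, k⟩
    exact congrFun (hblock i) k
  simpa [mul_comm] using hrow.rank_matrix
end

section
/- Let t : ℤ → ℝ be a nondecreasing knot sequence and let B_{i,k} denote the order-k B-spline basis functions for t. Then for every i and every k ≥ 1 with tᵢ < t_{i+k}, B_{i,k}(x) > 0 for all x in the open interval (tᵢ, t_{i+k}). -/
/-- `bomega t i k x = (x − tᵢ)/(t_{i+k−1} − tᵢ)` if `tᵢ ≠ t_{i+k−1}`, and `0` otherwise. -/
noncomputable def bomega (t : ℤ → ℝ) (i : ℤ) (k : ℕ) (x : ℝ) : ℝ :=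
  if t i ≠ t (i + (k : ℤ) - 1) then (x - t i) / (t (i + (k : ℤ) - 1) - t i) else 0

/-- The order-`k` B-spline basis functions for the knot sequence `t`:
`B_{i,1}` is the characteristic function of `[tᵢ, t_{i+1})`, and for `k > 1`,
`B_{i,k} = ω_{i,k}·B_{i,k−1} + (1 − ω_{i+1,k})·B_{i+1,k−1}`.  (Order `0` is set to `0`.) -/
noncomputable def Bspline (t : ℤ → ℝ) : ℕ → ℤ → ℝ → ℝ
  | 0, _, _ => 0
  | 1, i, x => if t i ≤ x ∧ x < t (i + 1) then 1 else 0
  | (k + 2), i, x =>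
      bomega t i (k + 2) x * Bspline t (k + 1) i x
        + (1 - bomega t (i + 1) (k + 2) x) * Bspline t (k + 1) (i + 1) x

theorem Bspline_eq_zero_of_notMem {t : ℤ → ℝ} (ht : Monotone t) (k : ℕ) (i : ℤ) {x : ℝ}
    (hx : x ∉ Set.Ico (t i) (t (i + (k : ℤ)))) : Bspline t k i x = 0 := by
  induction k using Nat.twoStepInduction generalizing i with
  | zero => rfl
  | one => simpa [Bspline] using hx
  | more k _ ih =>
    have h₁ : Bspline t (k + 1) i x = 0 := ih i fun h =>
      hx ⟨h.1, h.2.trans_le (ht (by push_cast; omega))⟩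
    have h₂ : Bspline t (k + 1) (i + 1) x = 0 := ih (i + 1) fun h =>
      hx ⟨(ht (by omega)).trans h.1, h.2.trans_le (ht (by push_cast; omega))⟩
    simp [Bspline, h₁, h₂]

theorem bomega_nonneg {t : ℤ → ℝ} (ht : Monotone t) (i : ℤ) {k : ℕ} (hk : 1 ≤ k) {x : ℝ}
    (hx : t i ≤ x) : 0 ≤ bomega t i k x := by
  unfold bomega
  split_ifs
  · exact div_nonneg (sub_nonneg.2 hx) (sub_nonneg.2 (ht (by omega)))
  · rfl

theorem bomega_pos {t : ℤ → ℝ} {i : ℤ} {k : ℕ} {x : ℝ} (hx : t i < x)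
    (hx' : x < t (i + (k : ℤ) - 1)) : 0 < bomega t i k x := by
  have h := hx.trans hx'
  rw [bomega, if_pos h.ne]
  exact div_pos (sub_pos.2 hx) (sub_pos.2 h)

theorem bomega_lt_one {t : ℤ → ℝ} {i : ℤ} {k : ℕ} {x : ℝ} (hx : t i ≤ x)
    (hx' : x < t (i + (k : ℤ) - 1)) : bomega t i k x < 1 := by
  have h := hx.trans_lt hx'
  rw [bomega, if_pos h.ne, div_lt_one (sub_pos.2 h)]
  linarith

theorem bomega_mul_Bspline_nonneg {t : ℤ → ℝ} (ht : Monotone t) (k : ℕ) (i : ℤ) {x : ℝ}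
    (h : 0 ≤ Bspline t (k + 1) i x) : 0 ≤ bomega t i (k + 2) x * Bspline t (k + 1) i x := by
  by_cases hx : x ∈ Set.Ico (t i) (t (i + ((k + 1 : ℕ) : ℤ)))
  · exact mul_nonneg (bomega_nonneg ht i (by omega) hx.1) h
  · rw [Bspline_eq_zero_of_notMem ht _ _ hx, mul_zero]

theorem one_sub_bomega_pos {t : ℤ → ℝ} (ht : Monotone t) (k : ℕ) (i : ℤ) {x : ℝ}
    (hx : x ∈ Set.Ico (t i) (t (i + ((k + 1 : ℕ) : ℤ)))) : 0 < 1 - bomega t i (k + 2) x :=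
  sub_pos.2 (bomega_lt_one hx.1 (hx.2.trans_le (ht (by push_cast; omega))))

theorem one_sub_bomega_mul_Bspline_nonneg {t : ℤ → ℝ} (ht : Monotone t) (k : ℕ) (i : ℤ) {x : ℝ}
    (h : 0 ≤ Bspline t (k + 1) i x) :
    0 ≤ (1 - bomega t i (k + 2) x) * Bspline t (k + 1) i x := by
  by_cases hx : x ∈ Set.Ico (t i) (t (i + ((k + 1 : ℕ) : ℤ)))
  · exact mul_nonneg (one_sub_bomega_pos ht k i hx).le h
  · rw [Bspline_eq_zero_of_notMem ht _ _ hx, mul_zero]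

theorem Bspline_nonneg {t : ℤ → ℝ} (ht : Monotone t) (k : ℕ) (i : ℤ) (x : ℝ) :
    0 ≤ Bspline t k i x := by
  induction k using Nat.twoStepInduction generalizing i with
  | zero => exact le_rfl
  | one => unfold Bspline; split_ifs <;> norm_num
  | more k _ ih =>
    exact add_nonneg (bomega_mul_Bspline_nonneg ht k i (ih i))
      (one_sub_bomega_mul_Bspline_nonneg ht k (i + 1) (ih (i + 1)))

/-- Positivity on the half-open support, where the left endpoint is allowed only if it is a knot
of multiplicity at least the order. -/
theorem Bspline_pos_of_mem_Ico {t : ℤ → ℝ} (ht : Monotone t) (k : ℕ) (i : ℤ) {x : ℝ}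
    (hx : x ∈ Set.Ico (t i) (t (i + ((k + 1 : ℕ) : ℤ))))
    (hleft : t i < x ∨ t (i + (k : ℤ)) ≤ x) : 0 < Bspline t (k + 1) i x := by
  induction k generalizing i with
  | zero =>
    have h : t i ≤ x ∧ x < t (i + 1) := by simpa using hx
    simp [Bspline, h]
  | succ k ih =>
    have hfst := bomega_mul_Bspline_nonneg ht k i (Bspline_nonneg ht (k + 1) i x)
    have hsnd := one_sub_bomega_mul_Bspline_nonneg ht k (i + 1)
      (Bspline_nonneg ht (k + 1) (i + 1) x)
    rcases lt_or_ge x (t (i + ((k + 1 : ℕ) : ℤ))) with hlt | hge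
    · have hi : t i < x := hleft.resolve_right hlt.not_ge
      exact add_pos_of_pos_of_nonneg (mul_pos
        (bomega_pos hi (hlt.trans_le (ht (by push_cast; omega))))
        (ih i ⟨hx.1, hlt⟩ (.inl hi))) hsnd
    · have hmem : x ∈ Set.Ico (t (i + 1)) (t (i + 1 + ((k + 1 : ℕ) : ℤ))) :=
        ⟨(ht (by push_cast; omega)).trans hge,
          hx.2.trans_le (ht (by push_cast; omega))⟩
      exact add_pos_of_nonneg_of_pos hfst (mul_pos (one_sub_bomega_pos ht k (i + 1) hmem)
        (ih (i + 1) hmem (.inr ((ht (by push_cast; omega)).trans hge))))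

/-- A B-spline basis function of order `k ≥ 1` for a nondecreasing knot sequence is
strictly positive on the open interval `(tᵢ, t_{i+k})` whenever `tᵢ < t_{i+k}`. -/
theorem bspline_pos (t : ℤ → ℝ) (ht : Monotone t) (i : ℤ) (k : ℕ) (hk : 1 ≤ k)
    (hik : t i < t (i + (k : ℤ))) (x : ℝ) (hx : x ∈ Set.Ioo (t i) (t (i + (k : ℤ)))) :
    0 < Bspline t k i x := by
  obtain ⟨k, rfl⟩ := Nat.exists_eq_add_of_le' hk
  exact Bspline_pos_of_mem_Ico ht k i ⟨hx.1.le, hx.2⟩ (.inl hx.1)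
end

section
/- Let t : ℤ → ℝ be a nondecreasing knot sequence with tᵢ < t_{i+1}, let B_{j,4} denote the order-4 B-spline basis functions for t, and let α : ℤ → ℝ be zero for all but finitely many indices. Then Σⱼ αⱼ B_{j,4}(x) ≥ 0 for all x ∈ [tᵢ, t_{i+1}) if and only if there exist real numbers c₁₁, c₁₂, c₂₂, d₁₁, d₁₂, d₂₂ with c₁₁ ≥ 0, c₂₂ ≥ 0, d₁₁ ≥ 0, d₂₂ ≥ 0, c₁₂² ≤ c₁₁c₂₂, d₁₂² ≤ d₁₁d₂₂, such that for all x ∈ [tᵢ, t_{i+1}): Σⱼ αⱼ B_{j,4}(x) = (x − tᵢ)(c₁₁x² + 2c₁₂x + c₂₂) + (t_{i+1} − x)(d₁₁x² + 2d₁₂x + d₂₂). -/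
open Polynomial in
theorem exists_polynomial_eq_bomega (t : ℤ → ℝ) (j : ℤ) (k : ℕ) :
    ∃ p : ℝ[X], p.natDegree ≤ 1 ∧ ∀ x, bomega t j k x = p.eval x := by
  by_cases h : t j ≠ t (j + (k : ℤ) - 1)
  · refine ⟨C (t (j + (k : ℤ) - 1) - t j)⁻¹ * (X - C (t j)), ?_, fun x ↦ ?_⟩
    · exact (natDegree_C_mul_le _ _).trans (natDegree_X_sub_C _).le
    · simp only [bomega, if_pos h, eval_mul, eval_C, eval_sub, eval_X]
      ring
  · exact ⟨0, by simp, fun x ↦ by simp only [bomega, if_neg h, eval_zero]⟩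

open Polynomial in
/-- On a single knot interval, a B-spline of order `k + 1` is a polynomial of degree at
most `k`. -/
theorem exists_polynomial_eq_Bspline_on_Ico {t : ℤ → ℝ} (ht : Monotone t) (i : ℤ) (k : ℕ)
    (j : ℤ) :
    ∃ p : ℝ[X], p.natDegree ≤ k ∧
      ∀ x ∈ Set.Ico (t i) (t (i + 1)), Bspline t (k + 1) j x = p.eval x := by
  induction k generalizing j with
  | zero =>
    rcases lt_trichotomy j i with hj | rfl | hj
    · refine ⟨0, by simp, fun x hx ↦ ?_⟩
      have := (ht (show j + 1 ≤ i by lia)).trans hx.1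
      simp [Bspline, this]
    · refine ⟨1, by simp, fun x hx ↦ ?_⟩
      simp [Bspline, hx.1, hx.2]
    · refine ⟨0, by simp, fun x hx ↦ ?_⟩
      have := hx.2.trans_le (ht (show i + 1 ≤ j by lia))
      simp [Bspline, this]
  | succ k ih =>
    obtain ⟨p, hp, hpe⟩ := ih j
    obtain ⟨q, hq, hqe⟩ := ih (j + 1)
    obtain ⟨v, hv, hve⟩ := exists_polynomial_eq_bomega t j (k + 2)
    obtain ⟨w, hw, hwe⟩ := exists_polynomial_eq_bomega t (j + 1) (k + 2)
    refine ⟨v * p + (1 - w) * q, ?_, fun x hx ↦ ?_⟩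
    · have hw' : (1 - w).natDegree ≤ 1 := (natDegree_sub_le _ _).trans (by simpa using hw)
      refine natDegree_add_le_of_degree_le ?_ ?_ <;>
        exact natDegree_mul_le.trans (by lia)
    · simp only [Bspline, hpe x hx, hqe x hx, hve, hwe, eval_add, eval_mul, eval_sub, eval_one]

open Polynomial in
theorem exists_polynomial_eq_finsum_Bspline_on_Ico {t : ℤ → ℝ} (ht : Monotone t) (i : ℤ)
    (k : ℕ) {α : ℤ → ℝ} (hfin : (Function.support α).Finite) :
    ∃ p : ℝ[X], p.natDegree ≤ k ∧ ∀ x ∈ Set.Ico (t i) (t (i + 1)),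
      ∑ᶠ j, α j * Bspline t (k + 1) j x = p.eval x := by
  choose p hp hpe using exists_polynomial_eq_Bspline_on_Ico ht i k
  refine ⟨∑ j ∈ hfin.toFinset, C (α j) * p j, ?_, fun x hx ↦ ?_⟩
  · exact natDegree_sum_le_of_forall_le _ _ fun j _ ↦ (natDegree_C_mul_le _ _).trans (hp j)
  · rw [finsum_eq_sum_of_support_subset (s := hfin.toFinset), eval_finsetSum]
    · exact Finset.sum_congr rfl fun j _ ↦ by rw [hpe j x hx, eval_mul, eval_C]
    · intro j hj
      simpa using left_ne_zero_of_mul hj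

theorem cubic_coeffs_of_nonneg {p₀ p₁ p₂ p₃ : ℝ}
    (hf : ∀ s : ℝ, 0 ≤ s → 0 ≤ p₀ + p₁ * s + p₂ * s ^ 2 + p₃ * s ^ 3) :
    0 ≤ p₀ ∧ 0 ≤ p₃ ∧ (p₃ = 0 → 0 ≤ p₂) ∧ (p₃ = 0 → p₂ = 0 → 0 ≤ p₁) := by
  refine ⟨by simpa using hf 0 le_rfl, ?_, ?_, ?_⟩
  · by_contra! h
    have hm : 0 ≤ |p₀| + |p₁| + |p₂| := by positivity
    set M := |p₀| + |p₁| + |p₂|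
    obtain ⟨s, hs1, hs⟩ : ∃ s : ℝ, 1 ≤ s ∧ p₃ * s = p₃ - M :=
      ⟨1 + M / (-p₃), by have := div_nonneg hm (neg_pos.2 h).le; linarith,
        by have := h.ne; field_simp; ring⟩
    have h0 := hf s (by linarith)
    have e0 : p₀ ≤ |p₀| * s ^ 2 := by
      nlinarith [le_abs_self p₀, abs_nonneg p₀, one_le_pow₀ hs1 (n := 2)]
    have e1 : p₁ * s ≤ |p₁| * s ^ 2 := by
      nlinarith [mul_le_mul_of_nonneg_right (le_abs_self p₁) (by linarith : 0 ≤ s),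
        mul_nonneg (abs_nonneg p₁) (by nlinarith : 0 ≤ s ^ 2 - s)]
    have e2 : p₂ * s ^ 2 ≤ |p₂| * s ^ 2 :=
      mul_le_mul_of_nonneg_right (le_abs_self p₂) (sq_nonneg s)
    have e3 : p₃ * s ^ 3 = (p₃ - M) * s ^ 2 := by rw [← hs]; ring
    nlinarith [mul_pos (neg_pos.2 h) (by positivity : 0 < s ^ 2)]
  · intro h3
    by_contra! h
    have hm : 0 ≤ |p₀| + |p₁| := by positivity
    set M := |p₀| + |p₁|
    obtain ⟨s, hs1, hs⟩ : ∃ s : ℝ, 1 ≤ s ∧ p₂ * s = p₂ - M :=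
      ⟨1 + M / (-p₂), by have := div_nonneg hm (neg_pos.2 h).le; linarith,
        by have := h.ne; field_simp; ring⟩
    have h0 := hf s (by linarith)
    have e0 : p₀ ≤ |p₀| * s := by nlinarith [le_abs_self p₀, abs_nonneg p₀]
    have e1 : p₁ * s ≤ |p₁| * s := mul_le_mul_of_nonneg_right (le_abs_self p₁) (by linarith)
    have e2 : p₂ * s ^ 2 = (p₂ - M) * s := by rw [← hs]; ring
    rw [h3] at h0
    nlinarith
  · intro h3 h2
    by_contra! h
    have hs := hf ((|p₀| + 1) / (-p₁)) (div_nonneg (by positivity) (by linarith))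
    have e : p₁ * ((|p₀| + 1) / (-p₁)) = -(|p₀| + 1) := by have := h.ne; field_simp
    rw [h3, h2, e] at hs
    linarith [le_abs_self p₀]

/-- A cubic nonnegative on `[0, ∞)` has the form `s * σ₁(s) + σ₀(s)`, where
`σ₁(s) = A s² + 2 B s + C` and `σ₀(s) = D s² + 2 E s + F` are positive semidefinite. -/
theorem exists_psd_of_cubic_nonneg {p₀ p₁ p₂ p₃ : ℝ}
    (hf : ∀ s : ℝ, 0 ≤ s → 0 ≤ p₀ + p₁ * s + p₂ * s ^ 2 + p₃ * s ^ 3) :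
    ∃ A B C D E F : ℝ, 0 ≤ A ∧ 0 ≤ C ∧ 0 ≤ D ∧ 0 ≤ F ∧ B ^ 2 ≤ A * C ∧ E ^ 2 ≤ D * F ∧
      p₃ = A ∧ p₂ = 2 * B + D ∧ p₁ = C + 2 * E ∧ p₀ = F := by
  obtain ⟨h0, h3, h2, h1⟩ := cubic_coeffs_of_nonneg hf
  -- Subtracting a multiple of `s` produces a double root at `s`.
  have of_crit : ∀ s : ℝ, 0 < s → 2 * p₃ * s ^ 3 + p₂ * s ^ 2 = p₀ →
      ∃ A B C D E F : ℝ, 0 ≤ A ∧ 0 ≤ C ∧ 0 ≤ D ∧ 0 ≤ F ∧ B ^ 2 ≤ A * C ∧ E ^ 2 ≤ D * F ∧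
        p₃ = A ∧ p₂ = 2 * B + D ∧ p₁ = C + 2 * E ∧ p₀ = F := by
    intro s hs he
    have hl : 0 ≤ (p₀ + p₁ * s + p₂ * s ^ 2 + p₃ * s ^ 3) / s := div_nonneg (hf s hs.le) hs.le
    refine ⟨p₃, -p₃ * s, p₃ * s ^ 2 + (p₀ + p₁ * s + p₂ * s ^ 2 + p₃ * s ^ 3) / s, p₀ / s ^ 2,
      -p₀ / s, p₀, h3, by positivity, by positivity, h0, ?_, ?_, rfl, ?_, ?_, rfl⟩
    · nlinarith [mul_nonneg h3 hl]
    · exact le_of_eq (by field_simp)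
    · field_simp
      linarith
    · field_simp
      linarith
  rcases h0.eq_or_lt with rfl | h0'
  · have hq : ∀ s : ℝ, 0 < s → 0 ≤ p₁ + p₂ * s + p₃ * s ^ 2 := fun s hs ↦
      nonneg_of_mul_nonneg_right (a := s) (by linarith [hf s hs.le]) hs
    have h1' : 0 ≤ p₁ := by
      have hc : Continuous fun s : ℝ ↦ p₁ + p₂ * s + p₃ * s ^ 2 := by fun_prop
      have := ge_of_tendsto (hc.continuousWithinAt (s := Set.Ioi 0) (x := 0))
        (Filter.eventually_of_mem self_mem_nhdsWithin hq)
      simpa using this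
    rcases le_total 0 p₂ with hp | hp
    · exact ⟨p₃, 0, p₁, p₂, 0, 0, h3, h1', hp, le_rfl, by simpa using mul_nonneg h3 h1',
        by simp, rfl, by ring, by ring, rfl⟩
    · refine ⟨p₃, p₂ / 2, p₁, 0, 0, 0, h3, h1', le_rfl, le_rfl, ?_, by simp, rfl, by ring,
        by ring, rfl⟩
      rcases h3.eq_or_lt with rfl | h3'
      · simp [le_antisymm hp (h2 rfl)]
      rcases hp.eq_or_lt with rfl | hp'
      · simpa using mul_nonneg h3 h1'
      have := hq (-p₂ / (2 * p₃)) (div_pos (by linarith) (by linarith))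
      have e : p₁ + p₂ * (-p₂ / (2 * p₃)) + p₃ * (-p₂ / (2 * p₃)) ^ 2 =
          (p₃ * p₁ - (p₂ / 2) ^ 2) / p₃ := by field_simp; ring
      rw [e, le_div_iff₀ h3', zero_mul] at this
      linarith
  rcases h3.eq_or_lt with rfl | h3'
  · rcases (h2 rfl).eq_or_lt with rfl | h2'
    · exact ⟨0, 0, p₁, 0, 0, p₀, le_rfl, h1 rfl rfl, le_rfl, h0, by simp, by simp, rfl, by ring,
        by ring, rfl⟩
    · refine of_crit √(p₀ / p₂) (by positivity) ?_
      rw [Real.sq_sqrt (by positivity)]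
      field_simp
      ring
  · set S := 1 + (p₀ + |p₂|) / p₃ with hS
    have hS1 : 1 ≤ S := by
      have : 0 ≤ (p₀ + |p₂|) / p₃ := by positivity
      linarith
    have hpS : p₃ * S = p₃ + p₀ + |p₂| := by rw [hS]; field_simp; ring
    have hc : ContinuousOn (fun s : ℝ ↦ 2 * p₃ * s ^ 3 + p₂ * s ^ 2) (Set.Icc 0 S) := by fun_prop
    have hend : p₀ ≤ 2 * p₃ * S ^ 3 + p₂ * S ^ 2 := by
      have e : 2 * p₃ * S ^ 3 = 2 * (p₃ + p₀ + |p₂|) * S ^ 2 := by rw [← hpS]; ring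
      rw [e]
      nlinarith [neg_abs_le p₂, abs_nonneg p₂, one_le_pow₀ hS1 (n := 2)]
    obtain ⟨s, hs, he⟩ := intermediate_value_Icc (by linarith) hc ⟨by simpa using h0, hend⟩
    refine of_crit s (hs.1.lt_of_ne ?_) he
    rintro rfl
    simp at he
    linarith

theorem binary_quadratic_nonneg {A B C : ℝ} (hA : 0 ≤ A) (hC : 0 ≤ C) (h : B ^ 2 ≤ A * C)
    (u v : ℝ) : 0 ≤ A * u ^ 2 + 2 * B * (u * v) + C * v ^ 2 := by
  rcases hA.eq_or_lt with rfl | hA'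
  · have : B = 0 := by nlinarith
    rw [this]
    nlinarith [mul_nonneg hC (sq_nonneg v)]
  · refine nonneg_of_mul_nonneg_right (a := A) ?_ hA'
    nlinarith [sq_nonneg (A * u + B * v), mul_nonneg (sub_nonneg.2 h) (sq_nonneg v)]

/-- Positive semidefinite forms in `x - a` and `b - x`, scaled by `r ≥ 0`, are positive
semidefinite quadratics in `x`. -/
theorem exists_psd_affine_change {A B C r : ℝ} (a b : ℝ) (hA : 0 ≤ A) (hC : 0 ≤ C)
    (h : B ^ 2 ≤ A * C) (hr : 0 ≤ r) :
    ∃ c₁₁ c₁₂ c₂₂ : ℝ, 0 ≤ c₁₁ ∧ 0 ≤ c₂₂ ∧ c₁₂ ^ 2 ≤ c₁₁ * c₂₂ ∧ ∀ x,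
      c₁₁ * x ^ 2 + 2 * c₁₂ * x + c₂₂ =
        r * (A * (x - a) ^ 2 + 2 * B * ((x - a) * (b - x)) + C * (b - x) ^ 2) := by
  refine ⟨r * (A * 1 ^ 2 + 2 * B * (1 * (-1)) + C * (-1) ^ 2),
    r * (-(A * a) + B * (a + b) - C * b),
    r * (A * (-a) ^ 2 + 2 * B * (-a * b) + C * b ^ 2),
    mul_nonneg hr (binary_quadratic_nonneg hA hC h _ _),
    mul_nonneg hr (binary_quadratic_nonneg hA hC h _ _), ?_, fun x ↦ by ring⟩
  have := mul_nonneg (sub_nonneg.2 h) (sq_nonneg (r * (b - a)))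
  linear_combination this

/-- Markov–Lukacs theorem for cubics on a half-open interval. -/
theorem exists_markovLukacs_of_cubic_nonneg {a b : ℝ} (hab : a < b) (e₀ e₁ e₂ e₃ : ℝ)
    (hf : ∀ x ∈ Set.Ico a b, 0 ≤ e₀ + e₁ * x + e₂ * x ^ 2 + e₃ * x ^ 3) :
    ∃ c₁₁ c₁₂ c₂₂ d₁₁ d₁₂ d₂₂ : ℝ,
      0 ≤ c₁₁ ∧ 0 ≤ c₂₂ ∧ 0 ≤ d₁₁ ∧ 0 ≤ d₂₂ ∧
      c₁₂ ^ 2 ≤ c₁₁ * c₂₂ ∧ d₁₂ ^ 2 ≤ d₁₁ * d₂₂ ∧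
      ∀ x, e₀ + e₁ * x + e₂ * x ^ 2 + e₃ * x ^ 3 =
        (x - a) * (c₁₁ * x ^ 2 + 2 * c₁₂ * x + c₂₂)
          + (b - x) * (d₁₁ * x ^ 2 + 2 * d₁₂ * x + d₂₂) := by
  have hg : ∀ s : ℝ, 0 ≤ s →
      0 ≤ (e₀ + e₁ * a + e₂ * a ^ 2 + e₃ * a ^ 3)
        + (3 * e₀ + e₁ * (2 * a + b) + e₂ * (a ^ 2 + 2 * a * b) + 3 * e₃ * a ^ 2 * b) * s
        + (3 * e₀ + e₁ * (a + 2 * b) + e₂ * (2 * a * b + b ^ 2) + 3 * e₃ * a * b ^ 2) * s ^ 2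
        + (e₀ + e₁ * b + e₂ * b ^ 2 + e₃ * b ^ 3) * s ^ 3 := by
    intro s hs
    have h1s : 0 < 1 + s := by linarith
    have hx := hf ((a + b * s) / (1 + s)) ⟨by rw [le_div_iff₀ h1s]; nlinarith,
      by rw [div_lt_iff₀ h1s]; nlinarith⟩
    refine (mul_nonneg (pow_pos h1s 3).le hx).trans_eq ?_
    field_simp
    ring
  obtain ⟨A, B, C, D, E, F, hA, hC, hD, hF, hB, hE, k3, k2, k1, k0⟩ :=
    exists_psd_of_cubic_nonneg hg
  have hba : 0 < b - a := sub_pos.2 hab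
  have hr : 0 ≤ ((b - a) ^ 3)⁻¹ := by positivity
  obtain ⟨c₁₁, c₁₂, c₂₂, hc1, hc2, hc, hce⟩ := exists_psd_affine_change a b hA hC hB hr
  obtain ⟨d₁₁, d₁₂, d₂₂, hd1, hd2, hd, hde⟩ := exists_psd_affine_change a b hD hF hE hr
  refine ⟨c₁₁, c₁₂, c₂₂, d₁₁, d₁₂, d₂₂, hc1, hc2, hd1, hd2, hc, hd, fun x ↦ ?_⟩
  rw [hce, hde]
  have hne : (b - a) ^ 3 ≠ 0 := by positivity
  refine mul_left_cancel₀ hne ?_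
  have hi : (b - a) ^ 3 * ((b - a) ^ 3)⁻¹ = 1 := mul_inv_cancel₀ hne
  linear_combination (x - a) ^ 3 * k3 + (x - a) ^ 2 * (b - x) * k2 + (x - a) * (b - x) ^ 2 * k1
    + (b - x) ^ 3 * k0
    - ((x - a) * (A * (x - a) ^ 2 + 2 * B * ((x - a) * (b - x)) + C * (b - x) ^ 2)
      + (b - x) * (D * (x - a) ^ 2 + 2 * E * ((x - a) * (b - x)) + F * (b - x) ^ 2)) * hi

/-- A cubic (order-4) B-spline with finitely supported coefficients is nonnegative on a
nondegenerate knot interval `[tᵢ, t_{i+1})` iff it admits a Markov–Lukacs representation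
there, with `(c₁₁, c₁₂, c₂₂)` and `(d₁₁, d₁₂, d₂₂)` corresponding to positive
semidefinite 2×2 symmetric matrices. -/
theorem bspline4_nonneg_on_interval_iff (t : ℤ → ℝ) (ht : Monotone t) (i : ℤ)
    (hi : t i < t (i + 1)) (α : ℤ → ℝ) (hfin : (Function.support α).Finite) :
    (∀ x ∈ Set.Ico (t i) (t (i + 1)), 0 ≤ ∑ᶠ j, α j * Bspline t 4 j x) ↔
      ∃ c₁₁ c₁₂ c₂₂ d₁₁ d₁₂ d₂₂ : ℝ,
        0 ≤ c₁₁ ∧ 0 ≤ c₂₂ ∧ 0 ≤ d₁₁ ∧ 0 ≤ d₂₂ ∧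
        c₁₂ ^ 2 ≤ c₁₁ * c₂₂ ∧ d₁₂ ^ 2 ≤ d₁₁ * d₂₂ ∧
        ∀ x ∈ Set.Ico (t i) (t (i + 1)),
          (∑ᶠ j, α j * Bspline t 4 j x) =
            (x - t i) * (c₁₁ * x ^ 2 + 2 * c₁₂ * x + c₂₂)
              + (t (i + 1) - x) * (d₁₁ * x ^ 2 + 2 * d₁₂ * x + d₂₂) := by
  constructor
  · obtain ⟨p, hp, hpe⟩ := exists_polynomial_eq_finsum_Bspline_on_Ico ht i 3 hfin
    have hpe' : ∀ x ∈ Set.Ico (t i) (t (i + 1)), ∑ᶠ j, α j * Bspline t 4 j x =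
        p.coeff 0 + p.coeff 1 * x + p.coeff 2 * x ^ 2 + p.coeff 3 * x ^ 3 := fun x hx ↦ by
      rw [hpe x hx, Polynomial.eval_eq_sum_range' (Nat.lt_succ_of_le hp)]
      simp [Finset.sum_range_succ]
    intro hnn
    obtain ⟨c₁₁, c₁₂, c₂₂, d₁₁, d₁₂, d₂₂, h1, h2, h3, h4, h5, h6, h⟩ :=
      exists_markovLukacs_of_cubic_nonneg hi _ _ _ _ fun x hx ↦ hpe' x hx ▸ hnn x hx
    exact ⟨c₁₁, c₁₂, c₂₂, d₁₁, d₁₂, d₂₂, h1, h2, h3, h4, h5, h6,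
      fun x hx ↦ (hpe' x hx).trans (h x)⟩
  · rintro ⟨c₁₁, c₁₂, c₂₂, d₁₁, d₁₂, d₂₂, h1, h2, h3, h4, h5, h6, h⟩ x hx
    rw [h x hx]
    have hc := binary_quadratic_nonneg h1 h2 h5 x 1
    have hd := binary_quadratic_nonneg h3 h4 h6 x 1
    refine add_nonneg (mul_nonneg (sub_nonneg.2 hx.1) ?_) (mul_nonneg (sub_nonneg.2 hx.2.le) ?_)
    · linarith
    · linarith
end
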